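/- Suppose n_i ≥ 1 for every i = 1, …, r, and let Δ be a pure, balanced simplicial complex on X with at least one facet. Then the simplicial complex Δ ∪ Δ_irr(n) is shellable. -/

import Mathlib

noncomputable section

/-- The vertex set `X` of `P^{n_1} × ⋯ × P^{n_r}`: pairs `(i, j)` with `i ∈ Fin r`,
`j ∈ Fin (n i + 1)` (so `0 ≤ j ≤ n_i`). -/
abbrev Vtx (r : ℕ) (n : Fin r → ℕ) : Type := (i : Fin r) × Fin (n i + 1)

/-- A simplicial complex: a collection of finite subsets closed under taking subsets. -/
def IsComplex {α : Type} (Δ : Finset α → Prop) : Prop :=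
  ∀ σ τ : Finset α, τ ⊆ σ → Δ σ → Δ τ

/-- A facet is a maximal face. -/
def IsFacet {α : Type} (Δ : Finset α → Prop) (F : Finset α) : Prop :=
  Δ F ∧ ∀ G : Finset α, Δ G → F ⊆ G → F = G

/-- A complex is pure if all facets have equal cardinality. -/
def IsPure {α : Type} (Δ : Finset α → Prop) : Prop :=
  ∀ F G : Finset α, IsFacet Δ F → IsFacet Δ G → F.card = G.card

/-- A face is relevant if it contains at least one vertex from every component. -/
def Relevant {r : ℕ} {n : Fin r → ℕ} (σ : Finset (Vtx r n)) : Prop :=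
  ∀ i : Fin r, ∃ v ∈ σ, v.1 = i

/-- A set of vertices is balanced if it contains exactly one vertex from each component. -/
def BalancedFace {r : ℕ} {n : Fin r → ℕ} (σ : Finset (Vtx r n)) : Prop :=
  ∀ i : Fin r, ∃! j : Fin (n i + 1), (⟨i, j⟩ : Vtx r n) ∈ σ

/-- A facet of the irrelevant complex: an `r`-element subset of `X` containing
exactly one pair of distinct vertices lying in the same component. -/
def IsIrrFacet {r : ℕ} {n : Fin r → ℕ} (τ : Finset (Vtx r n)) : Prop :=
  τ.card = r ∧
    ∃ v w : Vtx r n, v ∈ τ ∧ w ∈ τ ∧ v ≠ w ∧ v.1 = w.1 ∧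
      ∀ a b : Vtx r n, a ∈ τ → b ∈ τ → a ≠ b → a.1 = b.1 →
        (a = v ∧ b = w) ∨ (a = w ∧ b = v)

/-- The irrelevant complex `Δ_irr(n)`: faces are the subsets of the facets above. -/
def irrComplex (r : ℕ) (n : Fin r → ℕ) : Finset (Vtx r n) → Prop :=
  fun σ => ∃ τ : Finset (Vtx r n), σ ⊆ τ ∧ IsIrrFacet τ

/-- `F : Fin m → Finset α` is a shelling of `Δ`: an ordering `F 0, …, F (m-1)` of all
facets of `Δ` such that for each `i > 0` the subcomplex of faces of `F i` contained in
some earlier facet is pure of dimension `(F i).card - 2` (i.e. of codimension 1). -/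
def IsShelling {α : Type} (Δ : Finset α → Prop) {m : ℕ} (F : Fin m → Finset α) : Prop :=
  Function.Injective F ∧ (∀ i, IsFacet Δ (F i)) ∧ (∀ G, IsFacet Δ G → ∃ i, F i = G) ∧
    ∀ i : Fin m, 0 < (i : ℕ) → ∀ σ : Finset α, σ ⊆ F i → (∃ k, k < i ∧ σ ⊆ F k) →
      ∃ τ : Finset α, σ ⊆ τ ∧ τ ⊆ F i ∧ τ.card + 1 = (F i).card ∧ ∃ k, k < i ∧ τ ⊆ F k

/-- A complex is shellable if it is pure and admits a shelling. -/
def Shellable {α : Type} (Δ : Finset α → Prop) : Prop :=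
  IsPure Δ ∧ ∃ (m : ℕ) (F : Fin m → Finset α), IsShelling Δ F

/-- A pure complex is gallery-connected if any two facets are joined by a sequence of
facets in which consecutive facets meet in codimension 1. -/
def GalleryConnected {α : Type} [DecidableEq α] (Δ : Finset α → Prop) : Prop :=
  ∀ F F' : Finset α, IsFacet Δ F → IsFacet Δ F' →
    ∃ (m : ℕ) (g : ℕ → Finset α), g 0 = F ∧ g m = F' ∧ (∀ i ≤ m, IsFacet Δ (g i)) ∧
      ∀ i < m, (g i ∩ g (i + 1)).card + 1 = (g i).card

/-- An enumeration of the facets that is sorted by `key` is a shelling as soon as every pair of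
facets `G ≠ F` with `key G ≤ key F` is separated by a vertex `v ∈ F \ G` for which `F \ {v}` lies
in a facet of strictly smaller key. -/
theorem exists_isShelling_of_key {α : Type} [DecidableEq α] {K : Type} [LinearOrder K]
    {Δ : Finset α → Prop} (S : Finset (Finset α)) (hS : ∀ F, F ∈ S ↔ IsFacet Δ F)
    (key : Finset α → K)
    (h : ∀ F ∈ S, ∀ G ∈ S, G ≠ F → key G ≤ key F →
      ∃ v ∈ F, v ∉ G ∧ ∃ H ∈ S, key H < key F ∧ F.erase v ⊆ H) :
    ∃ (m : ℕ) (F : Fin m → Finset α), IsShelling Δ F := by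
  classical
  let f : Fin S.card → K := fun i => key (S.equivFin.symm i)
  let e : Fin S.card ≃ S := (Tuple.sort f).trans S.equivFin.symm
  have hmono : Monotone fun i => key (e i) := Tuple.monotone_sort f
  refine ⟨S.card, fun i => (e i : Finset α), ?_, ?_, ?_, ?_⟩
  · exact Subtype.val_injective.comp e.injective
  · exact fun i => (hS _).1 (e i).2
  · exact fun G hG => ⟨e.symm ⟨G, (hS G).2 hG⟩, by simp⟩
  · rintro i - σ hσ ⟨k, hk, hσk⟩
    obtain ⟨v, hv, hvG, H, hH, hlt, hsub⟩ := h (e i) (e i).2 (e k) (e k).2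
      (fun heq => hk.ne (e.injective (Subtype.ext heq))) (hmono hk.le)
    refine ⟨(e i : Finset α).erase v, ?_, Finset.erase_subset _ _,
      Finset.card_erase_add_one hv, e.symm ⟨H, hH⟩, ?_, by simpa using hsub⟩
    · exact Finset.subset_erase.2 ⟨hσ, fun hvσ => hvG (hσk hvσ)⟩
    · by_contra! hle
      have := hmono hle
      simp only [Equiv.apply_symm_apply] at this
      exact absurd hlt this.not_gt

/-- The number of vertices of `σ` in the `i`-th component. -/
def compCard {r : ℕ} {n : Fin r → ℕ} (σ : Finset (Vtx r n)) (i : Fin r) : ℕ :=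
  (σ.filter fun x => x.1 = i).card

/-- `σ` has two vertices in component `d`, none in component `z` and one in every other. -/
def HasType {r : ℕ} {n : Fin r → ℕ} (d z : Fin r) (σ : Finset (Vtx r n)) : Prop :=
  d ≠ z ∧ ∀ i, compCard σ i = if i = d then 2 else if i = z then 0 else 1

/-- The balanced set of vertices `x_{i, p i}`. -/
def graphFace {r : ℕ} {n : Fin r → ℕ} (p : (i : Fin r) → Fin (n i + 1)) : Finset (Vtx r n) :=
  Finset.univ.image fun i => ⟨i, p i⟩

section

variable {r : ℕ} {n : Fin r → ℕ} {σ τ : Finset (Vtx r n)}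

theorem card_eq_sum_compCard (σ : Finset (Vtx r n)) : σ.card = ∑ i, compCard σ i :=
  Finset.card_eq_sum_card_fiberwise fun _ _ => Finset.mem_coe.2 (Finset.mem_univ _)

theorem compCard_pos {x : Vtx r n} (hx : x ∈ σ) : 0 < compCard σ x.1 :=
  Finset.card_pos.2 ⟨x, by simp [hx]⟩

theorem two_le_compCard {x y : Vtx r n} (hx : x ∈ σ) (hy : y ∈ σ) (hne : x ≠ y)
    (h : x.1 = y.1) : 2 ≤ compCard σ x.1 :=
  Finset.one_lt_card.2 ⟨x, by simp [hx], y, by simp [hy, h], hne⟩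

theorem compCard_insert_erase {v w : Vtx r n} (hv : v ∈ σ) (hw : w ∉ σ) (i : Fin r) :
    compCard (insert w (σ.erase v)) i + (if v.1 = i then 1 else 0)
      = compCard σ i + (if w.1 = i then 1 else 0) := by
  have hins {ρ : Finset (Vtx r n)} {x : Vtx r n} (hx : x ∉ ρ) :
      compCard (insert x ρ) i = compCard ρ i + if x.1 = i then 1 else 0 := by
    unfold compCard
    rw [Finset.filter_insert]
    split_ifs <;> simp [hx]
  have hσ := hins (Finset.notMem_erase v σ)
  rw [Finset.insert_erase hv] at hσ
  rw [hins fun h => hw (Finset.mem_of_mem_erase h), hσ]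
  omega

theorem BalancedFace.exists_eq_graphFace (h : BalancedFace σ) : ∃ p, σ = graphFace p := by
  choose p hp hu using h
  refine ⟨p, ?_⟩
  ext ⟨i, a⟩
  simp only [graphFace, Finset.mem_image, Finset.mem_univ, true_and]
  constructor
  · intro ha
    exact ⟨i, by rw [hu i a ha]⟩
  · rintro ⟨j, hj⟩
    exact hj ▸ hp j

theorem mem_graphFace {p : (i : Fin r) → Fin (n i + 1)} {x : Vtx r n} :
    x ∈ graphFace p ↔ x = ⟨x.1, p x.1⟩ := by
  simp only [graphFace, Finset.mem_image, Finset.mem_univ, true_and]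
  constructor
  · rintro ⟨j, rfl⟩
    rfl
  · exact fun h => ⟨x.1, h.symm⟩

theorem mk_mem_graphFace (p : (i : Fin r) → Fin (n i + 1)) (i : Fin r) :
    (⟨i, p i⟩ : Vtx r n) ∈ graphFace p := mem_graphFace.2 rfl

theorem compCard_eq_sdiff_add (p : (i : Fin r) → Fin (n i + 1)) (σ : Finset (Vtx r n))
    (i : Fin r) : compCard σ i
      = compCard (σ \ graphFace p) i + if (⟨i, p i⟩ : Vtx r n) ∈ σ then 1 else 0 := by
  have hinter : ((σ ∩ graphFace p).filter fun x => x.1 = i)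
      = if (⟨i, p i⟩ : Vtx r n) ∈ σ then {⟨i, p i⟩} else ∅ := by
    ext x
    simp only [Finset.mem_filter, Finset.mem_inter, mem_graphFace]
    constructor
    · rintro ⟨⟨hx, he⟩, rfl⟩
      rw [he] at hx
      rw [if_pos hx, Finset.mem_singleton]
      exact he
    · split_ifs with h
      · rw [Finset.mem_singleton]
        rintro rfl
        exact ⟨⟨h, rfl⟩, rfl⟩
      · simp
  have hsplit : (σ.filter fun x => x.1 = i) =
      ((σ \ graphFace p).filter fun x => x.1 = i) ∪
        ((σ ∩ graphFace p).filter fun x => x.1 = i) := by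
    rw [← Finset.filter_union, Finset.sdiff_union_inter]
  unfold compCard
  rw [hsplit, Finset.card_union_of_disjoint, hinter]
  · split_ifs <;> simp
  · exact Finset.disjoint_filter_filter (Finset.disjoint_sdiff_inter _ _)

theorem compCard_graphFace (p : (i : Fin r) → Fin (n i + 1)) (i : Fin r) :
    compCard (graphFace p) i = 1 := by
  rw [compCard_eq_sdiff_add p, Finset.sdiff_self, if_pos (mk_mem_graphFace p i)]
  simp [compCard]

theorem BalancedFace.compCard_eq_one (h : BalancedFace σ) (i : Fin r) : compCard σ i = 1 := by
  obtain ⟨p, rfl⟩ := h.exists_eq_graphFace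
  exact compCard_graphFace p i

theorem BalancedFace.card_eq (h : BalancedFace σ) : σ.card = r := by
  simp [card_eq_sum_compCard, h.compCard_eq_one]

theorem IsIrrFacet.exists_hasType (h : IsIrrFacet σ) : ∃ d z, HasType d z σ := by
  obtain ⟨hcard, v, w, hv, hw, hvw, heq, hu⟩ := h
  have hv' : v ∈ σ.erase w := Finset.mem_erase.2 ⟨hvw, hv⟩
  set I := (σ.erase w).image Sigma.fst with hI
  have hIcard : I.card + 1 = r := by
    rw [hI, Finset.card_image_of_injOn, Finset.card_erase_add_one hw, hcard]
    intro a ha b hb hab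
    simp only [Finset.coe_erase, Set.mem_sdiff, Finset.mem_coe, Set.mem_singleton_iff] at ha hb
    by_contra hne
    rcases hu a b ha.1 hb.1 hne hab with h | h
    · exact hb.2 h.2
    · exact ha.2 h.1
  obtain ⟨z, hz⟩ : ∃ z, Iᶜ = {z} := by
    rw [← Finset.card_eq_one, Finset.card_compl, Fintype.card_fin]
    omega
  have hzI : ∀ i, i ∉ I ↔ i = z := fun i => by
    rw [← Finset.mem_compl, hz, Finset.mem_singleton]
  have hmem : ∀ x ∈ σ, x.1 ∈ I := by
    intro x hx
    by_cases hxw : x = w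
    · subst hxw
      exact heq ▸ Finset.mem_image_of_mem _ hv'
    · exact Finset.mem_image_of_mem _ (Finset.mem_erase.2 ⟨hxw, hx⟩)
  refine ⟨v.1, z, fun h => (hzI v.1).2 h (hmem v hv), fun i => ?_⟩
  unfold compCard
  split_ifs with h1 h2
  · subst h1
    rw [Finset.card_eq_two]
    refine ⟨v, w, hvw, ?_⟩
    ext x
    simp only [Finset.mem_filter, Finset.mem_insert, Finset.mem_singleton]
    constructor
    · rintro ⟨hx, hxv⟩
      by_cases hxe : x = v
      · exact Or.inl hxe
      · rcases hu x v hx hv hxe hxv with h | h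
        · exact Or.inl h.1
        · exact Or.inr h.1
    · rintro (rfl | rfl)
      · exact ⟨hv, rfl⟩
      · exact ⟨hw, heq.symm⟩
  · subst h2
    rw [Finset.card_eq_zero, Finset.filter_eq_empty_iff]
    rintro x hx rfl
    exact (hzI x.1).2 rfl (hmem x hx)
  · have hi : i ∈ I := by
      by_contra h
      exact h2 ((hzI i).1 h)
    obtain ⟨x, hx, rfl⟩ := Finset.mem_image.1 hi
    rw [Finset.card_eq_one]
    refine ⟨x, Finset.eq_singleton_iff_unique_mem.2 ⟨by
      simp [Finset.mem_of_mem_erase hx], fun y hy => ?_⟩⟩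
    rw [Finset.mem_filter] at hy
    by_contra hne
    rcases hu x y (Finset.mem_of_mem_erase hx) hy.1 (Ne.symm hne) hy.2.symm with h | h
    · exact h1 (by rw [h.1])
    · exact h1 (by rw [h.1, heq])

theorem HasType.isIrrFacet {d z : Fin r} (h : HasType d z σ) : IsIrrFacet σ := by
  obtain ⟨hdz, hc⟩ := h
  refine ⟨?_, ?_⟩
  · have hsum : ∑ i, (compCard σ i + if i = z then 1 else 0)
        = ∑ i : Fin r, (1 + if i = d then 1 else 0) := by
      refine Finset.sum_congr rfl fun i _ => ?_
      rw [hc i]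
      split_ifs <;> simp_all
    simp only [Finset.sum_add_distrib, Finset.sum_ite_eq', Finset.mem_univ, if_true] at hsum
    rw [← card_eq_sum_compCard] at hsum
    simpa using hsum
  · have hd := hc d
    rw [if_pos rfl, compCard, Finset.card_eq_two] at hd
    obtain ⟨v, w, hvw, hf⟩ := hd
    have hmem : ∀ x, (x ∈ σ ∧ x.1 = d) ↔ (x = v ∨ x = w) := fun x => by
      rw [← Finset.mem_filter (p := fun y : Vtx r n => y.1 = d), hf, Finset.mem_insert,
        Finset.mem_singleton]
    have hv := (hmem v).2 (Or.inl rfl)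
    have hw := (hmem w).2 (Or.inr rfl)
    refine ⟨v, w, hv.1, hw.1, hvw, hv.2.trans hw.2.symm, fun a b ha hb hab heq => ?_⟩
    have h2 := two_le_compCard ha hb hab heq
    rw [hc] at h2
    have had : a.1 = d := by
      by_contra hne
      rw [if_neg hne] at h2
      split_ifs at h2 <;> omega
    rcases (hmem a).1 ⟨ha, had⟩ with rfl | rfl <;>
      rcases (hmem b).1 ⟨hb, heq ▸ had⟩ with rfl | rfl <;> simp_all

theorem isIrrFacet_iff_exists_hasType : IsIrrFacet σ ↔ ∃ d z, HasType d z σ :=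
  ⟨IsIrrFacet.exists_hasType, fun ⟨_, _, h⟩ => h.isIrrFacet⟩

theorem HasType.not_balancedFace {d z : Fin r} (h : HasType d z σ) : ¬ BalancedFace σ := by
  intro hb
  have h1 := hb.compCard_eq_one d
  rw [h.2 d, if_pos rfl] at h1
  omega

theorem insert_erase_sdiff_of_mem {A : Finset (Vtx r n)} {v w : Vtx r n} (hw : w ∈ A) :
    insert w (σ.erase v) \ A = (σ \ A).erase v := by
  rw [Finset.insert_sdiff_of_mem _ hw, Finset.erase_sdiff_comm]

theorem HasType.insert_erase_same {d z : Fin r} (h : HasType d z σ) {v w : Vtx r n}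
    (hv : v ∈ σ) (hw : w ∉ σ) (hvw : v.1 = w.1) : HasType d z (insert w (σ.erase v)) := by
  refine ⟨h.1, fun i => ?_⟩
  have h1 := compCard_insert_erase hv hw i
  rw [hvw, h.2 i] at h1
  omega

theorem HasType.insert_erase_double {d z : Fin r} (h : HasType d z σ) {v w : Vtx r n}
    (hv : v ∈ σ) (hw : w ∉ σ) (hvd : v.1 = d) (hwz : w.1 ≠ z) :
    HasType w.1 z (insert w (σ.erase v)) := by
  refine ⟨hwz, fun i => ?_⟩
  have h1 := compCard_insert_erase hv hw i
  have hdz := h.1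
  rw [h.2 i] at h1
  split_ifs at h1 ⊢ <;> omega

theorem HasType.insert_erase_zero {d z : Fin r} (h : HasType d z σ) {v w : Vtx r n}
    (hv : v ∈ σ) (hw : w ∉ σ) (hvd : v.1 ≠ d) (hvz : v.1 ≠ z) (hwz : w.1 = z) :
    HasType d v.1 (insert w (σ.erase v)) := by
  refine ⟨hvd.symm, fun i => ?_⟩
  have h1 := compCard_insert_erase hv hw i
  have hdz := h.1
  rw [h.2 i] at h1
  split_ifs at h1 ⊢ <;> omega

/-- A vertex outside `graphFace p` can be removed from an irrelevant facet, the rest lying in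
`graphFace p` or in an irrelevant facet closer to `graphFace p`. -/
theorem HasType.exists_closer {d z : Fin r} (h : HasType d z σ)
    (p : (i : Fin r) → Fin (n i + 1)) {v : Vtx r n} (hv : v ∈ σ) (hvp : v ∉ graphFace p) :
    ∃ H, (H = graphFace p ∨ ∃ d' z', HasType d' z' H) ∧
      (H \ graphFace p).card < (σ \ graphFace p).card ∧ σ.erase v ⊆ H := by
  have hvm : v ∈ σ \ graphFace p := Finset.mem_sdiff.2 ⟨hv, hvp⟩
  have hlt : ∀ w ∈ graphFace p,
      (insert w (σ.erase v) \ graphFace p).card < (σ \ graphFace p).card := fun w hw => by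
    rw [insert_erase_sdiff_of_mem hw]
    exact Finset.card_erase_lt_of_mem hvm
  by_cases hw : (⟨v.1, p v.1⟩ : Vtx r n) ∈ σ
  · have hne : v ≠ ⟨v.1, p v.1⟩ := fun he => hvp (mem_graphFace.2 he)
    have hvd : v.1 = d := by
      have h2 := two_le_compCard hv hw hne rfl
      rw [h.2] at h2
      split_ifs at h2 <;> first | assumption | omega
    by_cases hu : ∃ u ∈ σ, u ≠ v ∧ u ∉ graphFace p
    · obtain ⟨u, huσ, huv, hup⟩ := hu
      have hune : u ≠ ⟨u.1, p u.1⟩ := fun he => hup (mem_graphFace.2 he)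
      have hud : u.1 ≠ d := by
        intro hud
        have h2 := two_le_compCard (Finset.mem_sdiff.2 ⟨huσ, hup⟩) hvm huv (hud.trans hvd.symm)
        have h3 := compCard_eq_sdiff_add p σ u.1
        rw [hud, ← hvd, if_pos hw, h.2, if_pos hvd] at h3
        rw [hud, ← hvd] at h2
        omega
      have huz : u.1 ≠ z := by
        intro huz
        have h2 := compCard_pos huσ
        rw [h.2, if_neg hud, if_pos huz] at h2
        omega
      have hw' : (⟨u.1, p u.1⟩ : Vtx r n) ∉ σ := by
        intro hmem
        have h2 := two_le_compCard huσ hmem hune rfl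
        rw [h.2, if_neg hud, if_neg huz] at h2
        omega
      exact ⟨_, Or.inr ⟨_, _, h.insert_erase_double hv hw' hvd huz⟩,
        hlt _ (mk_mem_graphFace p _), Finset.subset_insert _ _⟩
    · push Not at hu
      refine ⟨graphFace p, Or.inl rfl, ?_, fun u hu' => ?_⟩
      · rw [Finset.sdiff_self, Finset.card_empty]
        exact Finset.card_pos.2 ⟨v, hvm⟩
      · rw [Finset.mem_erase] at hu'
        exact hu u hu'.2 hu'.1
  · exact ⟨_, Or.inr ⟨d, z, h.insert_erase_same hv hw rfl⟩,
      hlt _ (mk_mem_graphFace p _), Finset.subset_insert _ _⟩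

/-- Two distinct irrelevant facets with the same vertices outside `graphFace p` are separated by
a vertex whose exchange yields an irrelevant facet with the type of the smaller one in the first
coordinate in which the types differ. -/
theorem HasType.exists_exchange {d z d' z' : Fin r} (h : HasType d z σ) (h' : HasType d' z' τ)
    (p : (i : Fin r) → Fin (n i + 1)) (hN : σ \ graphFace p = τ \ graphFace p) (hne : τ ≠ σ) :
    ∃ v ∈ σ, v ∉ τ ∧ ∃ H, H \ graphFace p = σ \ graphFace p ∧ σ.erase v ⊆ H ∧
      ((d' ≠ d ∧ HasType d' z H) ∨ (d' = d ∧ z' ≠ z ∧ HasType d z' H)) := by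
  have hσ := compCard_eq_sdiff_add p σ
  have hτ := compCard_eq_sdiff_add p τ
  rw [← hN] at hτ
  simp only [h.2] at hσ
  simp only [h'.2] at hτ
  have hdz := h.1
  have hdz' := h'.1
  have hsd : ∀ v w : Vtx r n, v ∈ graphFace p → w ∈ graphFace p →
      insert w (σ.erase v) \ graphFace p = σ \ graphFace p := fun v w hv hw => by
    rw [insert_erase_sdiff_of_mem hw,
      Finset.erase_eq_of_notMem fun hm => (Finset.mem_sdiff.1 hm).2 hv]
  by_cases hd : d' = d
  · subst hd
    by_cases hz : z' = z
    · subst hz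
      refine absurd ?_ hne
      ext x
      by_cases hx : x ∈ graphFace p
      · rw [mem_graphFace] at hx
        have h1 := hσ x.1
        rw [hτ x.1, Nat.add_left_cancel_iff] at h1
        rw [hx]
        by_cases h2 : (⟨x.1, p x.1⟩ : Vtx r n) ∈ σ <;>
          by_cases h3 : (⟨x.1, p x.1⟩ : Vtx r n) ∈ τ <;> simp [h2, h3] at h1 ⊢
      · have : x ∈ σ \ graphFace p ↔ x ∈ τ \ graphFace p := by rw [hN]
        simpa [hx] using this.symm
    · have hzσ : (⟨z, p z⟩ : Vtx r n) ∉ σ := fun hm => by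
        have h1 := hσ z
        rw [if_pos hm, if_neg hdz.symm, if_pos rfl] at h1
        omega
      have h1 := hτ z'
      have h2 := hσ z'
      rw [if_neg hdz'.symm, if_pos rfl] at h1
      rw [if_neg hdz'.symm, if_neg hz] at h2
      have hvσ : (⟨z', p z'⟩ : Vtx r n) ∈ σ := by
        by_contra hm
        rw [if_neg hm] at h2
        omega
      have hvτ : (⟨z', p z'⟩ : Vtx r n) ∉ τ := fun hm => by
        rw [if_pos hm] at h1
        omega
      exact ⟨_, hvσ, hvτ, _, hsd _ _ (mk_mem_graphFace p _) (mk_mem_graphFace p z),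
        Finset.subset_insert _ _,
        Or.inr ⟨rfl, hz, h.insert_erase_zero hvσ hzσ hdz'.symm hz rfl⟩⟩
  · have h1 := hσ d
    have h2 := hτ d
    have h3 := hσ d'
    have h4 := hτ d'
    rw [if_pos rfl] at h1 h4
    rw [if_neg (Ne.symm hd)] at h2
    rw [if_neg hd] at h3
    have hvσ : (⟨d, p d⟩ : Vtx r n) ∈ σ := by
      by_contra hm
      rw [if_neg hm] at h1
      split_ifs at h2 <;> omega
    have hvτ : (⟨d, p d⟩ : Vtx r n) ∉ τ := fun hm => by
      rw [if_pos hm] at h2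
      rw [if_pos hvσ] at h1
      split_ifs at h2 <;> omega
    have hdz2 : d' ≠ z := fun he => by
      rw [if_pos he] at h3
      split_ifs at h3 h4 <;> omega
    have hwσ : (⟨d', p d'⟩ : Vtx r n) ∉ σ := fun hm => by
      rw [if_pos hm, if_neg hdz2] at h3
      split_ifs at h4 <;> omega
    exact ⟨_, hvσ, hvτ, _, hsd _ _ (mk_mem_graphFace p _) (mk_mem_graphFace p d'),
      Finset.subset_insert _ _,
      Or.inl ⟨hd, h.insert_erase_double hvσ hwσ rfl hdz2⟩⟩

/-- A ridge of a balanced set lies in an irrelevant facet when there are two components. -/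
theorem BalancedFace.exists_hasType_erase (h : BalancedFace σ) (hr : 2 ≤ r)
    (hn : ∀ i, 1 ≤ n i) {v : Vtx r n} (hv : v ∈ σ) :
    ∃ d z H, HasType d z H ∧ σ.erase v ⊆ H := by
  have : Nontrivial (Fin r) := Fin.nontrivial_iff_two_le.2 hr
  obtain ⟨j, hj⟩ := exists_ne v.1
  obtain ⟨a, -, hu⟩ := h j
  have : Nontrivial (Fin (n j + 1)) := Fin.nontrivial_iff_two_le.2 (by have := hn j; omega)
  obtain ⟨b, hb⟩ := exists_ne a
  have hw : (⟨j, b⟩ : Vtx r n) ∉ σ := fun hm => hb (hu b hm)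
  refine ⟨j, v.1, _, ⟨hj, fun i => ?_⟩, Finset.subset_insert ⟨j, b⟩ _⟩
  have h1 := compCard_insert_erase hv hw i
  rw [h.compCard_eq_one] at h1
  dsimp only at h1
  split_ifs at h1 ⊢ <;> omega

/-- The sorting key of the shelling: `graphFace p` first, then the irrelevant facets by distance to
`graphFace p`, doubled component and missing component, then the other balanced facets. -/
def shellingKey (p : (i : Fin r) → Fin (n i + 1)) (σ : Finset (Vtx r n)) : ℕ ×ₗ ℕ ×ₗ ℕ :=
  open Classical in
  toLex (if BalancedFace σ ∧ σ ≠ graphFace p then r + 1 else (σ \ graphFace p).card,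
    toLex (∑ i with compCard σ i = 2, (i : ℕ), ∑ i with compCard σ i = 0, (i : ℕ)))

theorem HasType.shellingKey_eq {d z : Fin r} (h : HasType d z σ)
    (p : (i : Fin r) → Fin (n i + 1)) :
    shellingKey p σ = toLex ((σ \ graphFace p).card, toLex ((d : ℕ), (z : ℕ))) := by
  have h2 : (Finset.univ.filter fun i => compCard σ i = 2) = {d} := by
    ext i
    have := h.1
    simp only [Finset.mem_filter, Finset.mem_univ, true_and, Finset.mem_singleton, h.2 i]
    split_ifs <;> simp_all
  have h0 : (Finset.univ.filter fun i => compCard σ i = 0) = {z} := by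
    ext i
    have := h.1
    simp only [Finset.mem_filter, Finset.mem_univ, true_and, Finset.mem_singleton, h.2 i]
    split_ifs <;> simp_all
  rw [shellingKey, if_neg fun hb => h.not_balancedFace hb.1, h2, h0]
  simp

theorem isFacet_union_irrComplex_iff {Δ : Finset (Vtx r n) → Prop}
    (hbal : ∀ F, IsFacet Δ F → BalancedFace F) {F : Finset (Vtx r n)} :
    IsFacet (fun σ => Δ σ ∨ irrComplex r n σ) F ↔ IsFacet Δ F ∨ IsIrrFacet F := by
  have hcard : ∀ G, IsFacet Δ G ∨ IsIrrFacet G → G.card = r := by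
    rintro G (h | h)
    · exact (hbal G h).card_eq
    · exact h.1
  have hface : ∀ G, IsFacet Δ G ∨ IsIrrFacet G → Δ G ∨ irrComplex r n G := by
    rintro G (h | h)
    · exact Or.inl h.1
    · exact Or.inr ⟨G, subset_rfl, h⟩
  have hext : ∀ G, Δ G ∨ irrComplex r n G → ∃ G', G ⊆ G' ∧ (IsFacet Δ G' ∨ IsIrrFacet G') := by
    rintro G (h | ⟨G', hsub, h⟩)
    · obtain ⟨G', hle, hmax⟩ := (Set.toFinite {A | Δ A}).exists_le_maximal h
      exact ⟨G', hle, Or.inl ⟨hmax.prop, fun A hA hsub => hmax.eq_of_le hA hsub⟩⟩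
    · exact ⟨G', hsub, Or.inr h⟩
  constructor
  · rintro ⟨hF, hmax⟩
    obtain ⟨G, hsub, hG⟩ := hext F hF
    rwa [hmax G (hface G hG) hsub]
  · refine fun hF => ⟨hface F hF, fun G hG hsub => Finset.eq_of_subset_of_card_le hsub ?_⟩
    obtain ⟨G', hsub', hG'⟩ := hext G hG
    exact ((Finset.card_le_card hsub').trans_eq (hcard G' hG')).trans_eq (hcard F hF).symm

end

/-- If every `n_i ≥ 1` and `Δ` is a pure, balanced simplicial complex
with at least one facet, then `Δ ∪ Δ_irr(n)` is shellable. -/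
theorem balanced_union_irrComplex_shellable
    {r : ℕ} (hr : 1 ≤ r) {n : Fin r → ℕ} (hn : ∀ i : Fin r, 1 ≤ n i)
    (Δ : Finset (Vtx r n) → Prop) (hΔ : IsComplex Δ) (hpure : IsPure Δ)
    (hbal : ∀ F : Finset (Vtx r n), IsFacet Δ F → BalancedFace F)
    (hne : ∃ F : Finset (Vtx r n), IsFacet Δ F) :
    Shellable (fun σ : Finset (Vtx r n) => Δ σ ∨ irrComplex r n σ) := by
  classical
  have hcard : ∀ F, IsFacet (fun σ => Δ σ ∨ irrComplex r n σ) F → F.card = r := fun F hF => by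
    rcases (isFacet_union_irrComplex_iff hbal).1 hF with h | h
    · exact (hbal F h).card_eq
    · exact h.1
  refine ⟨fun F G hF hG => (hcard F hF).trans (hcard G hG).symm, ?_⟩
  obtain ⟨F₀, hF₀⟩ := hne
  obtain ⟨p, rfl⟩ := (hbal F₀ hF₀).exists_eq_graphFace
  refine exists_isShelling_of_key (Finset.univ.filter
    (IsFacet fun σ => Δ σ ∨ irrComplex r n σ)) (by simp) (shellingKey p) ?_
  simp only [Finset.mem_filter, Finset.mem_univ, true_and, isFacet_union_irrComplex_iff hbal,
    isIrrFacet_iff_exists_hasType]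
  have hkey₀ : shellingKey p (graphFace p) = toLex (0, toLex (0, 0)) := by
    simp [shellingKey, compCard_graphFace]
  rintro F (hF | ⟨d, z, hF⟩) G hG hGF hle
  · by_cases hF0 : F = graphFace p
    · subst hF0
      exfalso
      have hpos : 0 < (G \ graphFace p).card := by
        rw [Finset.card_pos, Finset.sdiff_nonempty]
        refine fun hsub => hGF (Finset.eq_of_subset_of_card_le hsub ?_)
        rw [hcard _ ((isFacet_union_irrComplex_iff hbal).2
          (hG.imp_right isIrrFacet_iff_exists_hasType.2)), (hbal _ hF).card_eq]
      rw [hkey₀, shellingKey, Prod.Lex.toLex_le_toLex] at hle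
      dsimp only at hle
      rcases hle with hle | ⟨hle, -⟩ <;> split_ifs at hle <;> omega
    · have hkF : ∃ q, shellingKey p F = toLex (r + 1, q) :=
        ⟨_, by rw [shellingKey, if_pos ⟨hbal F hF, hF0⟩]⟩
      obtain ⟨q, hkF⟩ := hkF
      obtain ⟨v, hv, hvG⟩ : ∃ v ∈ F, v ∉ G := by
        by_contra! hsub
        refine hGF (Finset.eq_of_subset_of_card_le hsub ?_).symm
        rw [hcard _ ((isFacet_union_irrComplex_iff hbal).2
          (hG.imp_right isIrrFacet_iff_exists_hasType.2)), (hbal _ hF).card_eq]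
      refine ⟨v, hv, hvG, ?_⟩
      rcases hr.eq_or_lt with h1 | h2
      · refine ⟨graphFace p, Or.inl hF₀, ?_, ?_⟩
        · rw [hkey₀, hkF, Prod.Lex.toLex_lt_toLex]
          exact Or.inl (Nat.succ_pos r)
        · have : F.erase v = ∅ := by
            rw [← Finset.card_eq_zero, Finset.card_erase_of_mem hv, (hbal F hF).card_eq, ← h1]
          simp [this]
      · obtain ⟨d, z, H, hH, hsub⟩ := (hbal F hF).exists_hasType_erase h2 hn hv
        refine ⟨H, Or.inr ⟨d, z, hH⟩, ?_, hsub⟩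
        rw [hH.shellingKey_eq, hkF, Prod.Lex.toLex_lt_toLex]
        exact Or.inl (Nat.lt_succ_of_le
          ((Finset.card_le_card Finset.sdiff_subset).trans_eq hH.isIrrFacet.1))
  · by_cases hv : ∃ v ∈ F \ graphFace p, v ∉ G
    · obtain ⟨v, hv, hvG⟩ := hv
      rw [Finset.mem_sdiff] at hv
      obtain ⟨H, hH, hlt, hsub⟩ := hF.exists_closer p hv.1 hv.2
      refine ⟨v, hv.1, hvG, H, ?_⟩
      rcases hH with rfl | ⟨d', z', hH⟩
      · refine ⟨Or.inl hF₀, ?_, hsub⟩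
        rw [hkey₀, hF.shellingKey_eq, Prod.Lex.toLex_lt_toLex]
        exact Or.inl (by simpa using hlt)
      · refine ⟨Or.inr ⟨d', z', hH⟩, ?_, hsub⟩
        rw [hH.shellingKey_eq, hF.shellingKey_eq, Prod.Lex.toLex_lt_toLex]
        exact Or.inl hlt
    push Not at hv
    have hsubN : F \ graphFace p ⊆ G \ graphFace p := fun x hx =>
      Finset.mem_sdiff.2 ⟨hv x hx, (Finset.mem_sdiff.1 hx).2⟩
    have hFr : (F \ graphFace p).card ≤ r :=
      (Finset.card_le_card Finset.sdiff_subset).trans_eq hF.isIrrFacet.1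
    have hFpos : 0 < (F \ graphFace p).card := by
      rw [Finset.card_pos, Finset.sdiff_nonempty]
      intro hsub
      refine hF.not_balancedFace ?_
      rw [Finset.eq_of_subset_of_card_le hsub
        (by rw [(hbal _ hF₀).card_eq, hF.isIrrFacet.1])]
      exact hbal _ hF₀
    rcases hG with hG | ⟨d', z', hG⟩
    · exfalso
      by_cases hG0 : G = graphFace p
      · subst hG0
        have := Finset.card_le_card hsubN
        rw [Finset.sdiff_self, Finset.card_empty] at this
        omega
      · rw [hF.shellingKey_eq, shellingKey, if_pos ⟨hbal G hG, hG0⟩,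
          Prod.Lex.toLex_le_toLex] at hle
        dsimp only at hle
        omega
    · rw [hF.shellingKey_eq, hG.shellingKey_eq, Prod.Lex.toLex_le_toLex,
        Prod.Lex.toLex_le_toLex] at hle
      dsimp only at hle
      have hN : F \ graphFace p = G \ graphFace p :=
        Finset.eq_of_subset_of_card_le hsubN (by omega)
      rw [hN] at hle
      obtain ⟨v, hv, hvG, H, hHN, hsub, hH⟩ := hF.exists_exchange hG p hN hGF
      rcases hH with ⟨hd, hH⟩ | ⟨hd, hz, hH⟩
      · refine ⟨v, hv, hvG, H, Or.inr ⟨_, _, hH⟩, ?_, hsub⟩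
        rw [hH.shellingKey_eq, hF.shellingKey_eq, hHN, Prod.Lex.toLex_lt_toLex,
          Prod.Lex.toLex_lt_toLex]
        have := Fin.val_ne_of_ne hd
        exact Or.inr ⟨rfl, Or.inl (by dsimp only; omega)⟩
      · refine ⟨v, hv, hvG, H, Or.inr ⟨_, _, hH⟩, ?_, hsub⟩
        rw [hH.shellingKey_eq, hF.shellingKey_eq, hHN, Prod.Lex.toLex_lt_toLex,
          Prod.Lex.toLex_lt_toLex]
        have := Fin.val_ne_of_ne hz
        subst hd
        exact Or.inr ⟨rfl, Or.inr ⟨rfl, by dsimp only; omega⟩⟩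

end
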